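/- Let (R,𝔪) be a Noetherian local ring and M a finitely generated R-module of positive finiteness dimension t (i.e., t = inf{i : H^i_𝔪(M) is not finitely generated} > 0). Let n_0 be a positive integer with 𝔪^{n_0} H^i_𝔪(M) = 0 for all i < t. Then every filter regular sequence x_1,…,x_t on M contained in 𝔪^{2n_0} is an 𝔪^{n_0}-weak M-sequence, i.e., (x_1,…,x_{i-1})M :_M x_i ⊆ (x_1,…,x_{i-1})M :_M 𝔪^{n_0} for all i = 1,…,t. -/

import Mathlib

universe u

open IsLocalRing

/-- The `i`-th local cohomology module `H^i_J(M)`. -/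
noncomputable def lcoh {R : Type u} [CommRing R] (J : Ideal R) (i : ℕ)
    (M : Type u) [AddCommGroup M] [Module R M] : ModuleCat.{u} R :=
  (localCohomology J i).obj (ModuleCat.of R M)

/-- `x` is a filter regular sequence on `M`. -/
def IsFilterRegularSeq {R : Type u} [CommRing R] (𝔪 : Ideal R)
    (M : Type u) [AddCommGroup M] [Module R M] {s : ℕ} (x : Fin s → R) : Prop :=
  ∀ i : Fin s, ∀ m : M,
    x i • m ∈ (Ideal.span (x '' {j | j < i}) • ⊤ : Submodule R M) →
      ∃ n : ℕ, ∀ r ∈ 𝔪 ^ n, r • m ∈ (Ideal.span (x '' {j | j < i}) • ⊤ : Submodule R M)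

section
open CategoryTheory Limits Opposite
variable {R : Type u} [CommRing R]

noncomputable def psi {X X' : ChainComplex (ModuleCat.{u} R) ℕ} (φ : X' ⟶ X) (Y : ModuleCat.{u} R) :
    X.linearYonedaObj R Y ⟶ X'.linearYonedaObj R Y :=
  (HomologicalComplex.unopFunctor _ _).map
    (((((linearYoneda R _).obj Y).rightOp.mapHomologicalComplex _).map φ).op)

lemma psi_f {X X' : ChainComplex (ModuleCat.{u} R) ℕ} (φ : X' ⟶ X) (Y : ModuleCat.{u} R) (n : ℕ)
    (f : X.X n ⟶ Y) : ((psi φ Y).f n).hom f = φ.f n ≫ f := rfl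

lemma psi_naturality {X X' : ModuleCat.{u} R} {P : ProjectiveResolution X}
    {P' : ProjectiveResolution X'} {g : X' ⟶ X} (φ : P'.Hom P g) (Y : ModuleCat.{u} R) (n : ℕ) :
    ((Ext R (ModuleCat.{u} R) n).map g.op).app Y ≫ (P'.isoExt n Y).hom =
      (P.isoExt (R := R) n Y).hom ≫ HomologicalComplex.homologyMap (psi φ.hom Y) n := by
  have h1 := ProjectiveResolution.isoLeftDerivedObj_inv_naturality g P' P φ.hom
    (by simpa using φ.hom_f_zero_comp_π_f_zero) ((linearYoneda R _).obj Y).rightOp n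
  have h2 := HomologicalComplex.homologyOp_hom_naturality (psi φ.hom Y) n
  have h3 := (Iso.eq_inv_comp _).2 ((Category.assoc _ _ _).symm.trans
    ((Iso.comp_inv_eq _).2 h2.symm))
  have h1' := congrArg Quiver.Hom.unop h1
  have h3' := congrArg Quiver.Hom.unop h3
  have e1 := congrArg (fun z => z ≫ (HomologicalComplex.homologyUnop _ n).inv) h1'
  have e2 := congrArg (fun z => (P.isoLeftDerivedObj ((linearYoneda R _).obj Y).rightOp n).inv.unop ≫ z) h3'
  refine Eq.trans ?_ (e1.trans ?_)
  · rfl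
  · refine Eq.trans ?_ (e2.symm.trans ?_) <;> rfl

lemma cyc_exists (K : CochainComplex (ModuleCat.{u} R) ℕ) (n : ℕ) (f : K.X n)
    (hf : (K.d n (n+1)).hom f = 0) : ∃ z : K.cycles n, (K.iCycles n).hom z = f := by
  have hf' : (K.sc n).g.hom f = 0 := by
    have : (ComplexShape.up ℕ).next n = n + 1 := by simp
    rw [← this] at hf
    exact hf
  exact ⟨(K.sc n).moduleCatCyclesIso.inv.hom ⟨f, hf'⟩,
    (K.sc n).moduleCatCyclesIso_inv_iCycles_apply ⟨f, hf'⟩⟩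

lemma cyc_zero {K L : CochainComplex (ModuleCat.{u} R) ℕ} (ψ : K ⟶ L) (n : ℕ) (z : K.cycles n)
    (hz : (HomologicalComplex.homologyMap ψ n).hom ((K.homologyπ n).hom z) = 0) :
    (ψ.f n).hom ((K.iCycles n).hom z) ∈ LinearMap.range (L.d ((ComplexShape.up ℕ).prev n) n).hom := by
  refine ((L.sc n).moduleCat_pOpcycles_eq_zero_iff _).1 ?_
  have : K.homologyπ n ≫ HomologicalComplex.homologyMap ψ n ≫ L.homologyι n =
      K.iCycles n ≫ ψ.f n ≫ L.pOpcycles n := by simp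
  have h := congrArg (fun q => q.hom z) this
  simp only [ModuleCat.hom_comp, LinearMap.comp_apply] at h
  rw [hz, map_zero] at h
  exact h.symm

lemma extMk_zero_of_range {X : ModuleCat.{u} R} (P : ProjectiveResolution X) (Y : ModuleCat.{u} R)
    (n : ℕ) (f : P.complex.X n ⟶ Y) (hf : P.complex.d (n+1) n ≫ f = 0)
    (h : f ∈ LinearMap.range ((P.complex.linearYonedaObj R Y).d ((ComplexShape.up ℕ).prev n) n).hom) :
    P.extMk f (n+1) rfl hf = 0 := by
  obtain ⟨g, hg⟩ := h
  cases n with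
  | zero =>
    have h0 : (P.complex.linearYonedaObj R Y).d ((ComplexShape.up ℕ).prev 0) 0 = 0 := by
      apply HomologicalComplex.shape
      simp
    rw [h0] at hg
    have : f = 0 := hg.symm
    subst this
    simp
  | succ n =>
    rw [P.extMk_eq_zero_iff f _ rfl hf n rfl]
    have e : (ComplexShape.up ℕ).prev (n+1) = n := by simp
    generalize (ComplexShape.up ℕ).prev (n+1) = k at *
    subst e
    exact ⟨g, hg⟩

lemma smul_extMk {X : ModuleCat.{u} R} (P : ProjectiveResolution X) (Y : ModuleCat.{u} R)
    (n : ℕ) (f : P.complex.X n ⟶ Y) (hf : P.complex.d (n+1) n ≫ f = 0) (r : R) :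
    r • P.extMk f (n+1) rfl hf = P.extMk (r • f) (n+1) rfl (by simp [hf]) := by
  rw [Abelian.Ext.smul_eq_comp_mk₀, P.extMk_comp_mk₀]
  congr 1

lemma transfer {X : ModuleCat.{u} R} (Y : ModuleCat.{u} R) (n : ℕ) (e : Abelian.Ext X Y n) :
    ∃ c : ((Ext R (ModuleCat.{u} R) n).obj (op X)).obj Y,
      ∀ {X' : ModuleCat.{u} R} (g : X' ⟶ X) (r : R),
        (((Ext R (ModuleCat.{u} R) n).map g.op).app Y).hom (r • c) = 0 →
          (Abelian.Ext.mk₀ g).comp (r • e) (zero_add n) = 0 := by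
  let P := projectiveResolution X
  obtain ⟨f, hf, rfl⟩ := P.extMk_surjective e (n+1) rfl
  obtain ⟨z, hz⟩ := cyc_exists (P.complex.linearYonedaObj R Y) n f hf
  refine ⟨(P.isoExt (R := R) n Y).inv.hom (((P.complex.linearYonedaObj R Y).homologyπ n).hom z), ?_⟩
  intro X' g r h
  let P' := projectiveResolution X'
  let φ : P'.Hom P g :=
    { hom := ProjectiveResolution.lift g P' P
      hom_f_zero_comp_π_f_zero := by
        have := ProjectiveResolution.lift_commutes_zero g P' P
        simpa using this }
  rw [smul_extMk, P.mk₀_comp_extMk _ _ _ _ φ]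
  apply extMk_zero_of_range
  have hn := congrArg (fun q => q.hom (r • (P.isoExt (R := R) n Y).inv.hom
    (((P.complex.linearYonedaObj R Y).homologyπ n).hom z))) (psi_naturality φ Y n)
  simp only [ModuleCat.hom_comp, LinearMap.comp_apply] at hn
  rw [h, map_zero, map_smul (P.isoExt (R := R) n Y).hom.hom] at hn
  have hii : (P.isoExt (R := R) n Y).hom.hom ((P.isoExt (R := R) n Y).inv.hom
    (((P.complex.linearYonedaObj R Y).homologyπ n).hom z)) =
    (((P.complex.linearYonedaObj R Y).homologyπ n).hom z) := by
    rw [← LinearMap.comp_apply, ← ModuleCat.hom_comp, Iso.inv_hom_id]; rfl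
  rw [hii, ← map_smul] at hn
  have := cyc_zero _ _ _ hn.symm
  rw [map_smul, hz] at this
  exact this

noncomputable abbrev QQ (J : Ideal R) (k : ℕ) : ModuleCat.{u} R := ModuleCat.of R (R ⧸ J ^ k)

noncomputable def qpr (J : Ideal R) {k k' : ℕ} (h : k ≤ k') : QQ J k' ⟶ QQ J k :=
  ModuleCat.ofHom (Submodule.mapQ _ _ LinearMap.id (Ideal.pow_le_pow_right h))

/-- eventually zero in the direct system of Ext's -/
def EZ {J : Ideal R} {k : ℕ} {Y : ModuleCat.{u} R} {i : ℕ} (e : Abelian.Ext (QQ J k) Y i) : Prop :=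
  ∃ (k' : ℕ) (h : k ≤ k'), (Abelian.Ext.mk₀ (qpr J h)).comp e (zero_add i) = 0

lemma colim_zero {D : Type} [SmallCategory D] [IsFiltered D]
    (F : D ⥤ ModuleCat.{u} R) (j : D) (x : F.obj j) (c : Cocone F) (hc : IsColimit c)
    (h : (c.ι.app j).hom x = 0) : ∃ (l : D) (f : j ⟶ l), (F.map f).hom x = 0 := by
  have h1 : c.ι.app j x = c.ι.app j 0 := by
    rw [map_zero]; exact h
  have : PreservesFilteredColimitsOfSize.{0, 0} (forget (ModuleCat.{u} R)) :=
    preservesFilteredColimitsOfSize_shrink.{0, u, 0, u} _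
  have := this.preserves_filtered_colimits D
  obtain ⟨l, f, hf⟩ := (IsColimit.eq_iff' hc x 0).1 h1
  exact ⟨l, f, by rw [map_zero] at hf; exact hf⟩

instance filtered_opop : IsFiltered ℕᵒᵖᵒᵖ := IsFiltered.of_equivalence (opOpEquivalence ℕ).symm

lemma colim_zero' (D : ℕᵒᵖᵒᵖ ⥤ ModuleCat.{u} R ⥤ ModuleCat.{u} R) (Y : ModuleCat.{u} R)
    (k : ℕᵒᵖᵒᵖ) (x : (D.obj k).obj Y) (h : ((colimit.ι D k).app Y).hom x = 0) :
    ∃ (l : ℕᵒᵖᵒᵖ) (f : k ⟶ l), ((D.map f).app Y).hom x = 0 :=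
  colim_zero (D ⋙ (evaluation _ _).obj Y) k x
    (((evaluation _ _).obj Y).mapCocone (colimit.cocone D))
    (isColimitOfPreserves ((evaluation _ _).obj Y) (colimit.isColimit D)) h

lemma ez_of_lcoh (J : Ideal R) (i : ℕ) (M : Type u) [AddCommGroup M] [Module R M] (r : R)
    (hr : ∀ a : lcoh J i M, r • a = 0) (k : ℕ)
    (e : Abelian.Ext (QQ J k) (ModuleCat.of R M) i) : EZ (r • e) := by
  obtain ⟨c, hc⟩ := transfer (ModuleCat.of R M) i e
  obtain ⟨l, f, hf⟩ := colim_zero' (localCohomology.diagram (localCohomology.idealPowersDiagram J) i)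
    (ModuleCat.of R M) (op (op k)) (r • c) ((map_smul (ModuleCat.Hom.hom _) r c).trans (hr _))
  exact ⟨l.unop.unop, leOfHom f.unop.unop, hc (qpr J (leOfHom f.unop.unop)) r hf⟩

lemma dimshift {A B : Type u} [AddCommGroup A] [Module R A] [AddCommGroup B] [Module R B]
    [Module.Projective R A] (π : A →ₗ[R] B) (hπ : Function.Surjective π) {T : ModuleCat.{u} R}
    {i : ℕ} (e : Abelian.Ext (ModuleCat.of R B) T (i+1)) :
    ∃ x : Abelian.Ext (ModuleCat.of R (LinearMap.ker π)) T i,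
      ∀ (A' B' : Type u) [AddCommGroup A'] [Module R A'] [AddCommGroup B'] [Module R B']
        (π' : A' →ₗ[R] B') (_ : Function.Surjective π') (a : A' →ₗ[R] A) (b : B' →ₗ[R] B)
        (h : ∀ y, b (π' y) = π (a y)),
        (Abelian.Ext.mk₀ (ModuleCat.ofHom (a.restrict (p := LinearMap.ker π')
          (q := LinearMap.ker π) (fun y hy => by
            rw [LinearMap.mem_ker] at hy ⊢; rw [← h, hy, map_zero])))).comp x (zero_add i) = 0 →
        (Abelian.Ext.mk₀ (ModuleCat.ofHom b)).comp e (zero_add _) = 0 := by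
  have hS := LinearMap.shortExact_shortComplexKer hπ
  have hz : (Abelian.Ext.mk₀ π.shortComplexKer.g).comp e (zero_add _) = 0 := by
    have : Projective (π.shortComplexKer.X₂) := by
      change Projective (ModuleCat.of R A)
      infer_instance
    exact Abelian.Ext.eq_zero_of_projective _
  obtain ⟨x, rfl⟩ := Abelian.Ext.contravariant_sequence_exact₃ hS T e hz (add_comm 1 i)
  refine ⟨x, ?_⟩
  intro A' B' _ _ _ _ π' hπ' a b h hx
  have hS' := LinearMap.shortExact_shortComplexKer hπ'
  let φ : π'.shortComplexKer ⟶ π.shortComplexKer :=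
    { τ₁ := ModuleCat.ofHom (a.restrict (p := LinearMap.ker π')
          (q := LinearMap.ker π) (fun y hy => by
            rw [LinearMap.mem_ker] at hy ⊢; rw [← h, hy, map_zero]))
      τ₂ := ModuleCat.ofHom a
      τ₃ := ModuleCat.ofHom b
      comm₁₂ := by ext; rfl
      comm₂₃ := by ext y; exact (h y).symm }
  have hn := ShortComplex.ShortExact.extClass_naturality hS' hS φ
  have : (Abelian.Ext.mk₀ (ModuleCat.ofHom b)).comp (hS.extClass.comp x (add_comm 1 i)) (zero_add _) =
    ((Abelian.Ext.mk₀ φ.τ₃).comp hS.extClass (zero_add 1)).comp x (add_comm 1 i) :=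
      (Abelian.Ext.comp_assoc _ _ _ _ _ (by lia)).symm
  rw [this, ← hn, Abelian.Ext.comp_assoc (a₂₃ := i) _ _ _ _ (by lia) (by lia)]
  refine (congrArg (fun q => hS'.extClass.comp q (add_comm 1 i)) hx).trans ?_
  simp

lemma mk₀_zero_of_range {A B : Type u} [AddCommGroup A] [Module R A] [AddCommGroup B] [Module R B]
    {T : ModuleCat.{u} R} {i : ℕ} (x : Abelian.Ext (ModuleCat.of R B) T i) (f : A →ₗ[R] B)
    (h : (Abelian.Ext.mk₀ (ModuleCat.ofHom (LinearMap.range f).subtype)).comp x (zero_add i) = 0) :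
    (Abelian.Ext.mk₀ (ModuleCat.ofHom f)).comp x (zero_add i) = 0 := by
  have : ModuleCat.ofHom f = ModuleCat.ofHom f.rangeRestrict ≫
      ModuleCat.ofHom (LinearMap.range f).subtype := by ext; rfl
  rw [this, ← Abelian.Ext.mk₀_comp_mk₀_assoc, h, Abelian.Ext.comp_zero]

lemma tors_vanish [IsNoetherianRing R] (J : Ideal R) (T : ModuleCat.{u} R) (n : ℕ)
    (hT : ∀ r ∈ J ^ n, ∀ t : T, r • t = 0) (i : ℕ) :
    ∀ (N : Type u) [AddCommGroup N] [Module R N] [Module.Finite R N]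
      (e : Abelian.Ext (ModuleCat.of R N) T i),
      ∃ k : ℕ, ∀ S : Submodule R N, S ≤ J ^ k • ⊤ →
        (Abelian.Ext.mk₀ (ModuleCat.ofHom S.subtype)).comp e (zero_add i) = 0 := by
  induction i with
  | zero =>
    intro N _ _ _ e
    obtain ⟨f, rfl⟩ := (Abelian.Ext.mk₀_bijective _ _).2 e
    refine ⟨n, fun S hS => ?_⟩
    rw [Abelian.Ext.mk₀_comp_mk₀]
    have : ModuleCat.ofHom S.subtype ≫ f = 0 := by
      ext ⟨s, hs⟩
      change f.hom s = 0
      refine Submodule.smul_induction_on (hS hs) ?_ ?_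
      · intro r hr m _
        rw [map_smul]; exact hT r hr _
      · intro a b ha hb
        rw [map_add, ha, hb, add_zero]
    rw [this, Abelian.Ext.mk₀_zero]
  | succ i ih =>
    intro N _ _ _ e
    obtain ⟨d, π, hπ⟩ := Module.Finite.exists_fin' R N
    obtain ⟨x, hx⟩ := dimshift π hπ e
    obtain ⟨j, hj⟩ := ih (LinearMap.ker π) x
    obtain ⟨k₀, hk₀⟩ := Ideal.exists_pow_inf_eq_pow_smul J (LinearMap.ker π)
    refine ⟨k₀ + j, fun S hS => ?_⟩
    let S' : Submodule R (Fin d → R) := (J ^ (k₀ + j) • ⊤) ⊓ S.comap π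
    refine hx S' S (π.restrict (p := S') (q := S) fun y hy => hy.2) ?_ S'.subtype S.subtype
      (fun y => rfl) ?_
    · rintro ⟨s, hs⟩
      have h1 := hS hs
      rw [← LinearMap.range_eq_top.2 hπ, LinearMap.range_eq_map, ← Submodule.map_smul''] at h1
      obtain ⟨y, hy, rfl⟩ := h1
      exact ⟨⟨y, hy, hs⟩, rfl⟩
    · apply mk₀_zero_of_range
      apply hj
      rintro _ ⟨⟨⟨y, hy⟩, hy0⟩, rfl⟩
      have hyk : y ∈ LinearMap.ker π := by simpa [Subtype.ext_iff] using hy0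
      have h1 : y ∈ J ^ (k₀ + j) • ⊤ ⊓ LinearMap.ker π := ⟨hy.1, hyk⟩
      rw [hk₀ _ (Nat.le_add_right _ _), Nat.add_sub_cancel_left] at h1
      have h2 : y ∈ (J ^ j • (⊤ : Submodule R (LinearMap.ker π))).map (LinearMap.ker π).subtype := by
        rw [Submodule.map_smul'', Submodule.map_subtype_top]
        exact Submodule.smul_mono le_rfl inf_le_right h1
      obtain ⟨z, hz, rfl⟩ := h2
      exact hz

lemma tors_ez [IsNoetherianRing R] (J : Ideal R) (T : ModuleCat.{u} R) (n : ℕ)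
    (hT : ∀ r ∈ J ^ n, ∀ t : T, r • t = 0) (i : ℕ) (k : ℕ)
    (e : Abelian.Ext (QQ J k) T (i + 1)) : EZ e := by
  obtain ⟨x, hx⟩ := dimshift (Submodule.mkQ (J ^ k)) (Submodule.mkQ_surjective _) e
  obtain ⟨l, hl⟩ := tors_vanish J T n hT i _ x
  refine ⟨k + l, Nat.le_add_right _ _, ?_⟩
  refine hx R (R ⧸ J ^ (k + l)) (Submodule.mkQ (J ^ (k + l))) (Submodule.mkQ_surjective _)
    LinearMap.id _ (fun y => rfl) ?_
  apply mk₀_zero_of_range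
  apply hl
  rintro _ ⟨⟨y, hy⟩, rfl⟩
  have hy1 : y ∈ J ^ (k + l) := by simpa using hy
  have h2 : y ∈ (J ^ l • (⊤ : Submodule R (LinearMap.ker (Submodule.mkQ (J ^ k))))).map
      (LinearMap.ker (Submodule.mkQ (J ^ k))).subtype := by
    rw [Submodule.map_smul'', Submodule.map_subtype_top, Submodule.ker_mkQ, smul_eq_mul,
      ← pow_add, add_comm]
    exact hy1
  obtain ⟨z, hz, rfl⟩ := h2
  exact hz

/-- pullback along the projection -/
noncomputable def pb {J : Ideal R} {k k' : ℕ} (h : k ≤ k') {Y : ModuleCat.{u} R} {i : ℕ}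
    (e : Abelian.Ext (QQ J k) Y i) : Abelian.Ext (QQ J k') Y i :=
  (Abelian.Ext.mk₀ (qpr J h)).comp e (zero_add i)

lemma qpr_comp (J : Ideal R) {k k' k'' : ℕ} (h : k ≤ k') (h' : k' ≤ k'') :
    qpr J h' ≫ qpr J h = qpr J (h.trans h') := by
  ext
  rfl

section
variable {J : Ideal R} {k k' k'' : ℕ} {Y Z : ModuleCat.{u} R} {i : ℕ}

lemma pb_pb (h : k ≤ k') (h' : k' ≤ k'') (e : Abelian.Ext (QQ J k) Y i) :
    pb h' (pb h e) = pb (h.trans h') e := by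
  unfold pb
  rw [Abelian.Ext.mk₀_comp_mk₀_assoc, qpr_comp]

lemma pb_smul (h : k ≤ k') (r : R) (e : Abelian.Ext (QQ J k) Y i) : pb h (r • e) = r • pb h e := by
  unfold pb; rw [Abelian.Ext.comp_smul]

lemma pb_add (h : k ≤ k') (e e' : Abelian.Ext (QQ J k) Y i) : pb h (e + e') = pb h e + pb h e' := by
  unfold pb; rw [Abelian.Ext.comp_add]

lemma pb_zero (h : k ≤ k') : pb h (0 : Abelian.Ext (QQ J k) Y i) = 0 := by
  unfold pb; rw [Abelian.Ext.comp_zero]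

lemma pb_comp (h : k ≤ k') (e : Abelian.Ext (QQ J k) Y i) {j l : ℕ} (g : Abelian.Ext Y Z j)
    (hl : i + j = l) : pb h (e.comp g hl) = (pb h e).comp g hl := by
  subst hl
  exact (Abelian.Ext.comp_assoc _ _ _ _ _ (by lia)).symm

lemma EZ.iff (e : Abelian.Ext (QQ J k) Y i) : EZ e ↔ ∃ k', ∃ h : k ≤ k', pb h e = 0 := Iff.rfl

lemma EZ.of_pb {h : k ≤ k'} {e : Abelian.Ext (QQ J k) Y i} (H : EZ (pb h e)) : EZ e := by
  obtain ⟨l, hl, H⟩ := H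
  exact ⟨l, h.trans hl, (pb_pb h hl e).symm.trans H⟩

lemma EZ.mono {e : Abelian.Ext (QQ J k) Y i} (H : EZ e) :
    ∃ k', k ≤ k' ∧ ∀ l (h : k ≤ l), k' ≤ l → pb h e = 0 := by
  obtain ⟨k', h', H⟩ := H
  refine ⟨k', h', fun l h hl => ?_⟩
  rw [← pb_pb h' hl]
  exact (congrArg (pb hl) H).trans (pb_zero _)

lemma EZ.pb {e : Abelian.Ext (QQ J k) Y i} (H : EZ e) (h : k ≤ k') : EZ (pb h e) := by
  obtain ⟨l, hl, H⟩ := H.mono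
  refine ⟨max l k', le_max_right _ _, ?_⟩
  exact (pb_pb h _ e).trans (H _ _ (le_max_left _ _))

lemma EZ.add {e e' : Abelian.Ext (QQ J k) Y i} (H : EZ e) (H' : EZ e') : EZ (e + e') := by
  obtain ⟨l, hl, H⟩ := H.mono
  obtain ⟨l', hl', H'⟩ := H'.mono
  refine ⟨max l l', hl.trans (le_max_left _ _), ?_⟩
  refine (pb_add _ e e').trans ?_
  rw [H _ _ (le_max_left _ _), H' _ _ (le_max_right _ _), add_zero]

lemma EZ.zero : EZ (0 : Abelian.Ext (QQ J k) Y i) := ⟨k, le_rfl, pb_zero _⟩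

lemma EZ.sum {ι : Type*} (s : Finset ι) (e : ι → Abelian.Ext (QQ J k) Y i)
    (H : ∀ j, EZ (e j)) : EZ (∑ j ∈ s, e j) := by
  classical
  induction s using Finset.induction_on with
  | empty => simpa using EZ.zero
  | insert a s ha ih => rw [Finset.sum_insert ha]; exact (H a).add ih

lemma EZ.comp {e : Abelian.Ext (QQ J k) Y i} (H : EZ e) {j l : ℕ} (g : Abelian.Ext Y Z j)
    (hl : i + j = l) : EZ (e.comp g hl) := by
  obtain ⟨k', h', H⟩ := H
  refine ⟨k', h', (pb_comp h' e g hl).trans ?_⟩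
  exact (congrArg (fun q => q.comp g hl) H).trans (Abelian.Ext.zero_comp _ _ _ _ hl)

lemma EZ.comp_sum {ι : Type} [Fintype ι] (e : Abelian.Ext (QQ J k) Y i) (g : Y ⟶ Z) (c : ι → R)
    (gg : ι → (Y ⟶ Z)) (hg : g = ∑ j, c j • gg j)
    (H : ∀ j, EZ (c j • e.comp (Abelian.Ext.mk₀ (gg j)) (add_zero i))) :
    EZ (e.comp (Abelian.Ext.mk₀ g) (add_zero i)) := by
  rw [hg, Abelian.Ext.mk₀_sum, Abelian.Ext.comp_sum]
  refine EZ.sum _ _ fun j => ?_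
  rw [Abelian.Ext.mk₀_smul, Abelian.Ext.comp_smul]
  exact H j
end

lemma step_core {J : Ideal R} {B P N M M' : ModuleCat.{u} R} (α : B ⟶ P) (β : P ⟶ N) (wa : α ≫ β = 0)
    (hA : (ShortComplex.mk α β wa).ShortExact) (xx : B ⟶ M) (f : M ⟶ M') (wx : xx ≫ f = 0)
    (hX : (ShortComplex.mk xx f wx).ShortExact) (b : P ⟶ M) (bb : N ⟶ M')
    (hb : α ≫ b = xx) (hbb : b ≫ f = β ≫ bb) (r : R) (i : ℕ)
    (h1 : ∀ k (e : Abelian.Ext (QQ J k) B (i+1)), EZ (e.comp (Abelian.Ext.mk₀ α) (add_zero _)))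
    (h2 : ∀ k (e : Abelian.Ext (QQ J k) B (i+1)), EZ (r • e))
    (h3 : ∀ k (e : Abelian.Ext (QQ J k) M i), EZ (r • e))
    (h4 : ∀ k (e : Abelian.Ext (QQ J k) P i), EZ (e.comp (Abelian.Ext.mk₀ b) (add_zero _)))
    (k : ℕ) (ξ : Abelian.Ext (QQ J k) M' i) : EZ (r • ξ) := by
  let φ : ShortComplex.mk α β wa ⟶ ShortComplex.mk xx f wx :=
    { τ₁ := 𝟙 B
      τ₂ := b
      τ₃ := bb
      comm₁₂ := by simp [hb]
      comm₂₃ := by simp [hbb] }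
  have hn : hA.extClass = (Abelian.Ext.mk₀ bb).comp hX.extClass (zero_add 1) :=
    (Abelian.Ext.comp_mk₀_id _).symm.trans (ShortComplex.ShortExact.extClass_naturality hA hX φ)
  obtain ⟨k₁, hk₁, h⟩ := h1 k (ξ.comp hX.extClass rfl)
  have h' : (pb hk₁ (ξ.comp hX.extClass rfl)).comp (Abelian.Ext.mk₀ α) (add_zero _) = 0 :=
    (pb_comp hk₁ _ _ _).symm.trans h
  obtain ⟨η, hη⟩ := Abelian.Ext.covariant_sequence_exact₁ _ hA _ h' rfl
  rw [pb_comp] at hη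
  have hηb : (η.comp (Abelian.Ext.mk₀ bb) (add_zero _)).comp hX.extClass rfl =
      (pb hk₁ ξ).comp hX.extClass rfl := by
    rw [Abelian.Ext.comp_assoc_of_second_deg_zero, ← hn]; exact hη
  have hd : (pb hk₁ ξ + -(η.comp (Abelian.Ext.mk₀ bb) (add_zero _))).comp hX.extClass rfl = 0 := by
    rw [Abelian.Ext.add_comp, Abelian.Ext.neg_comp, hηb, add_neg_cancel]
  obtain ⟨ζ, hζ⟩ := Abelian.Ext.covariant_sequence_exact₃ _ hX _ rfl hd
  have hξ : pb hk₁ ξ = ζ.comp (Abelian.Ext.mk₀ f) (add_zero _) +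
      η.comp (Abelian.Ext.mk₀ bb) (add_zero _) := by
    rw [eq_add_neg_iff_add_eq] at hζ
    exact hζ.symm
  apply EZ.of_pb (h := hk₁)
  rw [pb_smul, hξ, smul_add, ← Abelian.Ext.smul_comp, ← Abelian.Ext.smul_comp]
  refine ((h3 _ ζ).comp _ _).add ?_
  obtain ⟨k₂, hk₂, h⟩ := h2 k₁ (η.comp hA.extClass rfl)
  have h' : (pb hk₂ (r • η)).comp hA.extClass rfl = 0 := by
    rw [← pb_comp, Abelian.Ext.smul_comp]; exact h
  obtain ⟨ζ', hζ'⟩ := Abelian.Ext.covariant_sequence_exact₃ _ hA _ rfl h'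
  apply EZ.of_pb (h := hk₂)
  rw [pb_comp]
  rw [← hζ']
  have : (ζ'.comp (Abelian.Ext.mk₀ β) (add_zero _)).comp (Abelian.Ext.mk₀ bb) (add_zero _) =
    (ζ'.comp (Abelian.Ext.mk₀ b) (add_zero _)).comp (Abelian.Ext.mk₀ f) (add_zero _) := by
    rw [Abelian.Ext.comp_assoc_of_third_deg_zero, Abelian.Ext.comp_assoc_of_third_deg_zero,
      Abelian.Ext.mk₀_comp_mk₀, Abelian.Ext.mk₀_comp_mk₀, hbb]
  have h5 := (h4 _ ζ').comp (Abelian.Ext.mk₀ f) (add_zero _)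
  rw [← this] at h5
  exact h5

def PP (J : Ideal R) (n₀ t : ℕ) (Y : ModuleCat.{u} R) : Prop :=
  ∀ i < t, ∀ k (e : Abelian.Ext (QQ J k) Y i), ∀ r ∈ J ^ n₀, EZ (r • e)

lemma PP.tors {J : Ideal R} {n₀ t : ℕ} {Y : Type u} [AddCommGroup Y] [Module R Y]
    (H : PP J n₀ t (ModuleCat.of R Y)) (ht : 0 < t) (m : Y) (hm : ∃ k, ∀ r ∈ J ^ k, r • m = 0) :
    ∀ r ∈ J ^ n₀, r • m = 0 := by
  intro r hr
  obtain ⟨k, hk⟩ := hm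
  let g : (R ⧸ J ^ k) →ₗ[R] Y := Submodule.liftQ _ (LinearMap.toSpanSingleton R Y m)
    (fun s hs => by simpa using hk s hs)
  obtain ⟨k', h', e⟩ := H 0 ht k (Abelian.Ext.mk₀ (ModuleCat.ofHom g)) r hr
  rw [Abelian.Ext.comp_smul, Abelian.Ext.mk₀_comp_mk₀, ← Abelian.Ext.mk₀_smul,
    Abelian.Ext.mk₀_eq_zero_iff] at e
  have := congrArg (fun q => q.hom (Submodule.Quotient.mk 1)) e
  have h2 : r • ((1 : R) • m) = 0 := this
  simpa using h2

lemma lift_ez [IsNoetherianRing R] {J : Ideal R} {n₀ : ℕ} {M B : Type u} [AddCommGroup M]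
    [Module R M] [AddCommGroup B] [Module R B] (q : M →ₗ[R] B) (hq : Function.Surjective q)
    (hT : ∀ m, q m = 0 → ∀ r ∈ J ^ n₀, r • m = 0) {i k : ℕ}
    (e : Abelian.Ext (QQ J k) (ModuleCat.of R B) (i+1)) :
    ∃ k', ∃ h : k ≤ k', ∃ e' : Abelian.Ext (QQ J k') (ModuleCat.of R M) (i+1),
      pb h e = e'.comp (Abelian.Ext.mk₀ (ModuleCat.ofHom q)) (add_zero _) := by
  have hS := LinearMap.shortExact_shortComplexKer hq
  obtain ⟨k', h, H⟩ := tors_ez J (ModuleCat.of R (LinearMap.ker q)) n₀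
    (fun r hr y => Subtype.ext (hT y.1 y.2 r hr)) _ k (e.comp hS.extClass rfl)
  have h' : (pb h e).comp hS.extClass rfl = 0 := (pb_comp h e hS.extClass rfl).symm.trans H
  obtain ⟨e', he'⟩ := Abelian.Ext.covariant_sequence_exact₃ _ hS _ rfl h'
  exact ⟨k', h, e', he'.symm⟩

lemma step [IsNoetherianRing R] {J : Ideal R} {n₀ t : ℕ} {M M' : Type u} [AddCommGroup M]
    [Module R M] [AddCommGroup M'] [Module R M'] (H : PP J n₀ (t + 1) (ModuleCat.of R M))
    (x : R) (hx : x ∈ J ^ (2 * n₀)) (hxM : ∀ m : M, x • m = 0 → ∃ k, ∀ r ∈ J ^ k, r • m = 0)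
    (f : M →ₗ[R] M') (hf : Function.Surjective f) (hker : ∀ m, f m = 0 ↔ ∃ y, x • y = m) :
    PP J n₀ t (ModuleCat.of R M') := by
  have hgen : ∃ (n : ℕ) (a b : Fin n → R), (∀ j, a j ∈ J ^ n₀) ∧ (∀ j, b j ∈ J ^ n₀) ∧
      ∑ j, b j * a j = x := by
    rw [two_mul, pow_add] at hx
    obtain ⟨n, a, ha⟩ := Submodule.fg_iff_exists_fin_generating_family.1
      (IsNoetherian.noetherian (J ^ n₀))
    rw [← smul_eq_mul] at hx
    nth_rewrite 2 [← ha] at hx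
    rw [Submodule.mem_ideal_smul_span_iff_exists_sum] at hx
    obtain ⟨b, hb, hs⟩ := hx
    refine ⟨n, a, b, fun j => ?_, hb, ?_⟩
    · have : a j ∈ Submodule.span R (Set.range a) := Submodule.subset_span ⟨j, rfl⟩
      rwa [ha] at this
    · rw [← hs, Finsupp.sum_fintype _ _ (by simp)]; rfl
  obtain ⟨n, a, b, ha, hb, hab⟩ := hgen
  let T : Submodule R M := LinearMap.ker (LinearMap.lsmul R M x)
  have hT : ∀ m ∈ T, ∀ r ∈ J ^ n₀, r • m = 0 := fun m hm => H.tors (by lia) m (hxM m hm)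
  have hT' : ∀ m, T.mkQ m = 0 → ∀ r ∈ J ^ n₀, r • m = 0 := fun m hm => hT m (by simpa using hm)
  let α₀ : M →ₗ[R] (Fin n → M) := LinearMap.pi fun j => a j • LinearMap.id
  let α : (M ⧸ T) →ₗ[R] (Fin n → M) := T.liftQ α₀ (fun m hm => by
    rw [LinearMap.mem_ker]; ext j; exact hT m hm _ (ha j))
  let xx : (M ⧸ T) →ₗ[R] M := T.liftQ (LinearMap.lsmul R M x) le_rfl
  let bl : (Fin n → M) →ₗ[R] M := ∑ j, b j • LinearMap.proj j
  have hαb : ∀ y, bl (α y) = xx y := by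
    intro y
    obtain ⟨y, rfl⟩ := Submodule.mkQ_surjective _ y
    change bl (α₀ y) = x • y
    simp [bl, α₀, ← hab, Finset.sum_smul, mul_smul]
  have hxxi : Function.Injective xx := by
    rw [← LinearMap.ker_eq_bot]
    exact Submodule.ker_liftQ_eq_bot _ _ _ le_rfl
  have hαi : Function.Injective α := by
    intro y z hyz
    apply hxxi
    rw [← hαb, ← hαb, hyz]
  have hfx : ∀ y, f (xx y) = 0 := by
    intro y
    obtain ⟨y, rfl⟩ := Submodule.mkQ_surjective _ y
    exact (hker _).2 ⟨y, rfl⟩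
  let bb : ((Fin n → M) ⧸ LinearMap.range α) →ₗ[R] M' := Submodule.liftQ _ (f.comp bl) (by
    rintro _ ⟨y, rfl⟩
    rw [LinearMap.mem_ker, LinearMap.comp_apply, hαb, hfx])
  have wa : ModuleCat.ofHom α ≫ ModuleCat.ofHom (LinearMap.range α).mkQ = 0 := by
    ext y
    exact (Submodule.Quotient.mk_eq_zero _).2 ⟨_, rfl⟩
  have wx : ModuleCat.ofHom xx ≫ ModuleCat.ofHom f = 0 := by
    ext y
    exact hfx _
  intro i hi k e r hr
  have hB1 : ∀ k (e : Abelian.Ext (QQ J k) (ModuleCat.of R (M ⧸ T)) (i+1)), EZ (r • e) := by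
    intro k e
    obtain ⟨k', h, e', he⟩ := lift_ez T.mkQ T.mkQ_surjective hT' e
    apply EZ.of_pb (h := h)
    rw [pb_smul, he, ← Abelian.Ext.smul_comp]
    exact (H (i+1) (by lia) _ e' r hr).comp _ _
  refine step_core (J := J) (ModuleCat.ofHom α) (ModuleCat.ofHom (LinearMap.range α).mkQ) wa ?_
    (ModuleCat.ofHom xx) (ModuleCat.ofHom f) wx ?_ (ModuleCat.ofHom bl) (ModuleCat.ofHom bb)
    ?_ ?_ r i ?_ hB1 ?_ ?_ k e
  · exact ModuleCat.shortComplex_shortExact _ α.exact_map_mkQ_range hαi (Submodule.mkQ_surjective _)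
  · refine ModuleCat.shortComplex_shortExact _ ?_ hxxi hf
    intro m
    refine (hker m).trans ⟨?_, ?_⟩
    · rintro ⟨y, rfl⟩
      exact ⟨T.mkQ y, rfl⟩
    · rintro ⟨y, rfl⟩
      obtain ⟨y, rfl⟩ := Submodule.mkQ_surjective _ y
      exact ⟨y, rfl⟩
  · ext y
    exact hαb _
  · ext y
    rfl
  · intro k e
    obtain ⟨k', h, e', he⟩ := lift_ez T.mkQ T.mkQ_surjective hT' e
    apply EZ.of_pb (h := h)
    rw [pb_comp, he, Abelian.Ext.comp_assoc_of_third_deg_zero, Abelian.Ext.mk₀_comp_mk₀]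
    refine EZ.comp_sum e' _ a (fun j => ModuleCat.ofHom (LinearMap.single R (fun _ => M) j)) ?_ ?_
    · apply ModuleCat.hom_ext
      rw [ModuleCat.hom_sum]
      apply LinearMap.ext
      intro m
      rw [LinearMap.sum_apply]
      change α₀ m = ∑ j, a j • Pi.single j m
      ext l
      simp [α₀, Finset.sum_apply, Pi.single_apply]
    · intro j
      rw [← Abelian.Ext.smul_comp]
      exact (H (i+1) (by lia) _ e' _ (ha j)).comp _ _
  · intro k e
    exact H i (by lia) k e r hr
  · intro k e
    refine EZ.comp_sum e _ b (fun j => ModuleCat.ofHom (LinearMap.proj j)) ?_ ?_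
    · apply ModuleCat.hom_ext
      rw [ModuleCat.hom_sum]
      rfl
    · intro j
      exact H i (by lia) _ _ _ (hb j)

abbrev SS (M : Type u) [AddCommGroup M] [Module R M] {t : ℕ} (x : Fin t → R) (i : ℕ) :
    Submodule R M := Ideal.span (x '' {j | (j : ℕ) < i}) • ⊤

lemma SS_succ (M : Type u) [AddCommGroup M] [Module R M] {t : ℕ} (x : Fin t → R) (i : ℕ)
    (hi : i < t) (m : M) : m ∈ SS M x (i+1) ↔ ∃ y, m - x ⟨i, hi⟩ • y ∈ SS M x i := by
  have : x '' {j | (j : ℕ) < i + 1} = x '' {j | (j : ℕ) < i} ∪ {x ⟨i, hi⟩} := by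
    rw [← Set.image_singleton, ← Set.image_union]
    congr 1
    ext j
    simp only [Set.mem_setOf_eq, Set.union_singleton, Set.mem_insert_iff, Fin.ext_iff]
    lia
  unfold SS
  rw [this, Ideal.span_union, Submodule.sup_smul, Submodule.mem_sup]
  constructor
  · rintro ⟨y, hy, z, hz, rfl⟩
    rw [Submodule.ideal_span_singleton_smul] at hz
    obtain ⟨w, _, rfl⟩ := hz
    exact ⟨w, by simpa using hy⟩
  · rintro ⟨y, hy⟩
    exact ⟨_, hy, x ⟨i, hi⟩ • y,
      Submodule.smul_mem_smul (Ideal.mem_span_singleton_self _) trivial, by simp⟩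

lemma PP_quot [IsNoetherianRing R] {J : Ideal R} {n₀ t : ℕ} (M : Type u) [AddCommGroup M]
    [Module R M] (H : PP J n₀ t (ModuleCat.of R M)) (x : Fin t → R)
    (hfr : IsFilterRegularSeq J M x) (hx : ∀ i, x i ∈ J ^ (2 * n₀)) :
    ∀ i ≤ t, PP J n₀ (t - i) (ModuleCat.of R (M ⧸ SS M x i)) := by
  have mk0 : ∀ i (m : M), (SS M x i).mkQ m = 0 ↔ m ∈ SS M x i := fun i m => by
    simp
  intro i
  induction i with
  | zero =>
    intro _
    have h0 : SS M x 0 = ⊥ := by simp [SS]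
    intro i hi k e r hr
    let E : M ≃ₗ[R] (M ⧸ SS M x 0) := (Submodule.quotEquivOfEqBot _ h0).symm
    have he : e = (e.comp (Abelian.Ext.mk₀ (ModuleCat.ofHom E.symm.toLinearMap)) (add_zero _)).comp
        (Abelian.Ext.mk₀ (ModuleCat.ofHom E.toLinearMap)) (add_zero _) := by
      rw [Abelian.Ext.comp_assoc_of_third_deg_zero, Abelian.Ext.mk₀_comp_mk₀]
      have : ModuleCat.ofHom E.symm.toLinearMap ≫ ModuleCat.ofHom E.toLinearMap = 𝟙 _ := by
        apply ModuleCat.hom_ext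
        apply LinearMap.ext
        intro y
        exact E.apply_symm_apply y
      rw [this, Abelian.Ext.comp_mk₀_id]
    rw [he, ← Abelian.Ext.smul_comp]
    exact (H i (by simpa using hi) _ _ r hr).comp _ _
  | succ i ih =>
    intro hi
    have h1 := ih (by lia)
    rw [show t - i = (t - (i+1)) + 1 by lia] at h1
    refine step h1 (x ⟨i, hi⟩) (hx _) ?_
      ((SS M x i).liftQ (SS M x (i+1)).mkQ ?_) ?_ ?_
    · intro m hm
      obtain ⟨m, rfl⟩ := Submodule.mkQ_surjective _ m
      rw [← map_smul, mk0] at hm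
      obtain ⟨n, hn⟩ := hfr ⟨i, hi⟩ m hm
      refine ⟨n, fun r hr => ?_⟩
      rw [← map_smul, mk0]
      exact hn r hr
    · rw [Submodule.ker_mkQ]
      refine Submodule.smul_mono_left (Ideal.span_mono (Set.image_mono ?_))
      intro j (hj : (j : ℕ) < i)
      exact Nat.lt_succ_of_lt hj
    · intro y
      obtain ⟨y, rfl⟩ := Submodule.mkQ_surjective _ y
      exact ⟨(SS M x i).mkQ y, rfl⟩
    · intro m
      obtain ⟨m, rfl⟩ := Submodule.mkQ_surjective _ m
      refine (mk0 (i+1) m).trans ((SS_succ M x i hi m).trans ?_)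
      constructor
      · rintro ⟨y, hy⟩
        refine ⟨(SS M x i).mkQ y, ?_⟩
        rw [← mk0, map_sub, sub_eq_zero] at hy
        rw [hy, map_smul]
      · rintro ⟨y, hy⟩
        obtain ⟨y, rfl⟩ := Submodule.mkQ_surjective _ y
        refine ⟨y, ?_⟩
        rw [← mk0, map_sub, sub_eq_zero, map_smul, hy]
end

/-- if `M` has positive finiteness dimension `t` and
`𝔪^{n₀} H^i_𝔪(M) = 0` for all `i < t`, then every filter regular sequence
`x_1,…,x_t` on `M` contained in `𝔪^{2n₀}` is an `𝔪^{n₀}`-weak `M`-sequence. -/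
theorem filterRegular_isWeakSequence
    {R : Type u} [CommRing R] [IsNoetherianRing R] [IsLocalRing R]
    (M : Type u) [AddCommGroup M] [Module R M] [Module.Finite R M]
    (t n₀ : ℕ)
    (ht : sInf {i | ¬ Module.Finite R (lcoh (maximalIdeal R) i M)} = t) (ht0 : 0 < t)
    (hn₀ : 1 ≤ n₀)
    (hann : ∀ i < t, ∀ (a : lcoh (maximalIdeal R) i M),
      ∀ r ∈ maximalIdeal R ^ n₀, r • a = 0)
    (x : Fin t → R) (hfr : IsFilterRegularSeq (maximalIdeal R) M x)
    (hx : ∀ i, x i ∈ maximalIdeal R ^ (2 * n₀)) :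
    ∀ i : Fin t, ∀ m : M,
      x i • m ∈ (Ideal.span (x '' {j | j < i}) • ⊤ : Submodule R M) →
        ∀ r ∈ maximalIdeal R ^ n₀,
          r • m ∈ (Ideal.span (x '' {j | j < i}) • ⊤ : Submodule R M) := by
  intro i m hm r hr
  have H : PP (maximalIdeal R) n₀ t (ModuleCat.of R M) := fun i hi k e r hr =>
    ez_of_lcoh _ i M r (fun a => hann i hi a r hr) k e
  have h1 := PP_quot M H x hfr hx i i.2.le
  have mk0 : ∀ (m : M), (SS M x i).mkQ m = 0 ↔ m ∈ SS M x i := fun m => by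
    simp
  obtain ⟨n, hn⟩ := hfr i m hm
  have h2 := h1.tors (by have := i.2; lia) ((SS M x i).mkQ m)
    ⟨n, fun s hs => by rw [← map_smul, mk0]; exact hn s hs⟩ r hr
  rw [← map_smul, mk0] at h2
  exact h2
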